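/- Let L be a function field over a perfect field k and let R be an integral domain with k ⊆ R ⊆ L which is a finitely generated k-algebra, is not a field, and satisfies Frac(R) = L. Let R̄ be the integral closure of R in L. Then the map sending a place P of L centered on R (i.e., a valuation subring O_P ⊇ R with k ⊆ O_P ≠ L, and P its maximal ideal) to 𝔭 = P ∩ R̄ is a bijection from the set of places of L centered on R onto the set of maximal ideals of R̄; moreover for each such place, O_P equals the localization R̄_𝔭 and P = 𝔭·R̄_𝔭. -/

import Mathlib

open Polynomial

/-- The Horner partial evaluations of `f` at a root `z` of `f` lie in every valuation subring
containing the coefficients of `f`, together with their multiples by `z`. -/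
theorem ValuationSubring.aeval_divX_iterate_mem {A L : Type*} [CommRing A] [Field L] [Algebra A L]
    (V : ValuationSubring L) (hV : ∀ a : A, algebraMap A L a ∈ V) {f : A[X]} {z : L}
    (hf : aeval z f = 0) (j : ℕ) :
    aeval z (divX^[j] f) ∈ V ∧ z * aeval z (divX^[j] f) ∈ V := by
  rcases V.mem_or_inv_mem z with hz | hz
  · have h : ∀ g : A[X], aeval z g ∈ V := fun g => by
      rw [aeval_eq_sum_range]
      refine sum_mem fun i _ => ?_
      rw [Algebra.smul_def]
      exact MulMemClass.mul_mem (hV _) (pow_mem hz _)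
    exact ⟨h _, MulMemClass.mul_mem hz (h _)⟩
  · induction j with
    | zero => simp [hf]
    | succ j ih =>
      rw [Function.iterate_succ_apply']
      set g := divX^[j] f
      have hg : z * aeval z (divX g) = aeval z g - algebraMap A L (g.coeff 0) := by
        have h := congrArg (aeval z) (divX_mul_X_add g)
        rw [map_add, map_mul, aeval_X, aeval_C] at h
        rw [eq_sub_iff_add_eq, mul_comm, h]
      have hmem : z * aeval z (divX g) ∈ V := hg ▸ sub_mem ih.1 (hV _)
      refine ⟨?_, hmem⟩
      by_cases hz0 : z = 0
      · subst hz0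
        simpa [aeval_def, eval₂_at_zero] using hV _
      · simpa [hz0] using MulMemClass.mul_mem hz hmem

/-- An element algebraic over a principal ideal domain is a root of a polynomial whose
coefficients do not all lie in a given proper ideal. -/
theorem exists_aeval_eq_zero_and_coeff_notMem {A L : Type*} [CommRing A] [IsDomain A]
    [IsPrincipalIdealRing A] [Field L] [Algebra A L] [FaithfulSMul A L] {z : L}
    (hz : IsAlgebraic A z) {I : Ideal A} (hI : I ≠ ⊤) :
    ∃ f : A[X], aeval z f = 0 ∧ ∃ i, f.coeff i ∉ I := by
  classical
  let := UniqueFactorizationMonoid.strongNormalizationMonoid (α := A)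
  let := UniqueFactorizationMonoid.toNormalizedGCDMonoid A
  obtain ⟨f, hf0, hf⟩ := hz
  refine ⟨f.primPart, ?_, ?_⟩
  · rw [f.eq_C_content_mul_primPart, map_mul, aeval_C, mul_eq_zero] at hf
    refine hf.resolve_left fun h => hf0 ?_
    rw [← content_eq_zero_iff]
    exact (FaithfulSMul.algebraMap_eq_zero_iff A L).mp h
  · by_contra! h
    obtain ⟨d, rfl⟩ := (IsPrincipalIdealRing.principal I).principal
    refine hI (Ideal.span_singleton_eq_top.mpr (f.isPrimitive_primPart d ?_))
    rw [C_dvd_iff_dvd_coeff]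
    exact fun i => Ideal.mem_span_singleton.mp (h i)

/-- The localization at a proper ideal of a ring that is integrally closed in an algebraic
extension `L` of a principal ideal domain contains `z` or `z⁻¹` for each `z` in `L`. -/
theorem Subring.exists_notMem_mul_eq {A L : Type*} [CommRing A] [IsDomain A]
    [IsPrincipalIdealRing A] [Field L] [Algebra A L] [FaithfulSMul A L] [Algebra.IsAlgebraic A L]
    (B : Subring L) [IsIntegrallyClosedIn B L] (hAB : ∀ a : A, algebraMap A L a ∈ B)
    {I : Ideal B} (hI : I ≠ ⊤) (z : L) :
    ∃ b s : B, s ∉ I ∧ (z * (s : L) = b ∨ z * (b : L) = s) := by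
  let φ : A →+* B := (algebraMap A L).codRestrict B hAB
  obtain ⟨f, hf, i, hi⟩ := exists_aeval_eq_zero_and_coeff_notMem
    (Algebra.IsAlgebraic.isAlgebraic (R := A) z) (Ideal.comap_ne_top φ hI)
  have hmem : ∀ j, aeval z (divX^[j] f) ∈ B ∧ z * aeval z (divX^[j] f) ∈ B := fun j => by
    by_contra h
    have key : ∀ x : L, x ∉ B → ∃ V : ValuationSubring L, B ≤ V.toSubring ∧ x ∉ V :=
      fun x hx => B.exists_le_valuationSubring_of_isIntegrallyClosedIn hx
    rcases not_and_or.mp h with h | h <;> obtain ⟨V, hBV, hV⟩ := key _ h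
    · exact hV (V.aeval_divX_iterate_mem (fun a => hBV (hAB a)) hf j).1
    · exact hV (V.aeval_divX_iterate_mem (fun a => hBV (hAB a)) hf j).2
  by_contra! h
  refine hi ?_
  have hb : ∀ j, (⟨_, (hmem j).1⟩ : B) ∈ I := fun j => by
    by_contra hs
    exact (h ⟨_, (hmem j).2⟩ _ hs).1 rfl
  have hzb : ∀ j, (⟨_, (hmem j).2⟩ : B) ∈ I := fun j => by
    by_contra hs
    exact (h ⟨_, (hmem j).1⟩ _ hs).2 rfl
  have hcoeff : ∀ j, (divX^[j] f).coeff 0 = f.coeff j := fun j => by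
    have : ∀ m, (divX^[j] f).coeff m = f.coeff (m + j) := by
      induction j with
      | zero => simp
      | succ j ih =>
        intro m
        rw [Function.iterate_succ_apply', coeff_divX, ih]
        congr 1
        ring
    simpa using this 0
  have heq : φ (f.coeff i) = ⟨_, (hmem i).1⟩ - ⟨_, (hmem (i + 1)).2⟩ := by
    refine Subtype.ext ?_
    change algebraMap A L (f.coeff i) =
      aeval z (divX^[i] f) - z * aeval z (divX^[i + 1] f)
    rw [Function.iterate_succ_apply', ← hcoeff]
    have h := congrArg (aeval z) (divX_mul_X_add (divX^[i] f))
    rw [map_add, map_mul, aeval_X, aeval_C] at h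
    rw [eq_sub_iff_add_eq', mul_comm, h]
  rw [Ideal.mem_comap, heq]
  exact sub_mem (hb i) (hzb (i + 1))

/-- Noether normalization for a finitely generated domain of transcendence degree one. -/
theorem exists_polynomial_integral_inj_algHom {k R : Type*} [Field k] [CommRing R] [IsDomain R]
    [Algebra k R] [Algebra.FiniteType k R] (htr : Algebra.trdeg k R = 1) :
    ∃ g : k[X] →ₐ[k] R, Function.Injective g ∧ g.IsIntegral := by
  obtain ⟨s, g, hg, hint⟩ := exists_integral_inj_algHom_of_fg k R
  have hs : s = 1 := by
    algebraize [g.toRingHom]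
    have : FaithfulSMul (MvPolynomial (Fin s) k) R :=
      (faithfulSMul_iff_algebraMap_injective _ _).mpr hg
    have h := lift_trdeg_add_eq k (MvPolynomial (Fin s) k) R
    have h0 : Algebra.trdeg (MvPolynomial (Fin s) k) R = 0 := trdeg_eq_zero
    rw [h0, htr, MvPolynomial.trdeg_of_isDomain] at h
    simpa using h
  subst hs
  let e := MvPolynomial.uniqueAlgEquiv k (Fin 1)
  refine ⟨g.comp e.symm.toAlgHom, hg.comp e.symm.injective, ?_⟩
  exact RingHom.IsIntegral.trans e.symm.toAlgHom.toRingHom g.toRingHom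
    (RingHom.isIntegral_of_surjective _ e.symm.surjective) hint


/-- Places of a function field `L/k` centered on a finitely generated subalgebra `R` with
fraction field `L` (not a field) correspond bijectively to the maximal ideals of the
integral closure `R̄` of `R` in `L`, the valuation ring being the localization `R̄_𝔭` and
the place being `𝔭·R̄_𝔭`. -/
theorem stmt_19 {k L : Type*} [Field k] [PerfectField k] [Field L] [Algebra k L]
    (hfg : (⊤ : IntermediateField k L).FG)
    (htr : ∃ t : L, IsTranscendenceBasis k (fun _ : Unit => t))
    (R : Subalgebra k L) (hRfg : R.FG) (hRnf : ¬ IsField R)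
    (hRfrac : ∀ z : L, ∃ a b : R, b ≠ 0 ∧ z * (b : L) = (a : L)) :
    (∀ O : ValuationSubring L,
      (∀ a : k, algebraMap k L a ∈ O) → O ≠ ⊤ → (R : Set L) ⊆ O →
      ∃! 𝔭 : Ideal (integralClosure R L), 𝔭.IsMaximal ∧
        (∀ b : integralClosure R L, b ∈ 𝔭 ↔ (b : L) ∈ O.nonunits) ∧
        ((O : Set L) = {z : L | ∃ b s : integralClosure R L, s ∉ 𝔭 ∧ z * (s : L) = (b : L)}) ∧
        ({z : L | z ∈ O.nonunits} =
          {z : L | ∃ b s : integralClosure R L, b ∈ 𝔭 ∧ s ∉ 𝔭 ∧ z * (s : L) = (b : L)})) ∧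
    (∀ 𝔭 : Ideal (integralClosure R L), 𝔭.IsMaximal →
      ∃! O : ValuationSubring L,
        ((∀ a : k, algebraMap k L a ∈ O) ∧ O ≠ ⊤ ∧ (R : Set L) ⊆ O) ∧
        (∀ b : integralClosure R L, b ∈ 𝔭 ↔ (b : L) ∈ O.nonunits)) := by
  have halg : Algebra.IsAlgebraic R L := ⟨fun z => by
    obtain ⟨a, b, hb, h⟩ := hRfrac z
    refine ⟨C b * X - C a, fun h0 => hb ?_, ?_⟩
    · have h1 := congrArg (coeff · 1) h0
      rwa [coeff_sub, coeff_C_mul, coeff_X_one, mul_one, coeff_C_of_ne_zero one_ne_zero, sub_zero,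
        coeff_zero] at h1
    · rw [map_sub, map_mul, aeval_C, aeval_X, aeval_C, sub_eq_zero, mul_comm]
      exact h⟩
  have hft : Algebra.FiniteType k R := Subalgebra.fg_iff_finiteType R |>.mp hRfg
  have htrR : Algebra.trdeg k R = 1 := by
    obtain ⟨t, ht⟩ := htr
    have h1 := ht.lift_cardinalMk_eq_trdeg
    have h2 := trdeg_add_eq k R (A := L)
    rw [trdeg_eq_zero (R := R), add_zero] at h2
    rw [h2]
    simpa using h1.symm
  obtain ⟨g, hg, hint⟩ := exists_polynomial_integral_inj_algHom htrR
  have hdim : Ring.DimensionLEOne R := by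
    algebraize [g.toRingHom]
    exact Ring.DimensionLEOne.of_isIntegral k[X] R
  have hdimB : Ring.DimensionLEOne (integralClosure R L) := inferInstance
  have hRB : ∀ r : R, (r : L) ∈ integralClosure R L := fun r => (integralClosure R L).algebraMap_mem r
  have key : ∀ 𝔭 : Ideal (integralClosure R L), 𝔭 ≠ ⊤ → ∀ z : L,
      ∃ b s : integralClosure R L, s ∉ 𝔭 ∧ (z * (s : L) = b ∨ z * (b : L) = s) := by
    intro 𝔭 h𝔭 z
    let : Algebra k[X] R := g.toRingHom.toAlgebra
    let : Algebra k[X] L := ((algebraMap R L).comp g.toRingHom).toAlgebra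
    have : IsScalarTower k[X] R L := IsScalarTower.of_algebraMap_eq fun _ => rfl
    have : Algebra.IsIntegral k[X] R := ⟨hint⟩
    have : FaithfulSMul k[X] L := (faithfulSMul_iff_algebraMap_injective _ _).mpr
      ((FaithfulSMul.algebraMap_injective R L).comp hg)
    have : FaithfulSMul k[X] R := (faithfulSMul_iff_algebraMap_injective _ _).mpr hg
    have : Algebra.IsAlgebraic k[X] L := Algebra.IsAlgebraic.trans k[X] R L
    have : IsIntegrallyClosedIn (integralClosure R L).toSubring L :=
      inferInstanceAs (IsIntegrallyClosedIn (integralClosure R L) L)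
    exact Subring.exists_notMem_mul_eq (A := k[X]) (integralClosure R L).toSubring
      (fun a => hRB (g a)) (I := 𝔭) h𝔭 z
  have hBO : ∀ O : ValuationSubring L, (R : Set L) ⊆ O →
      ∀ b : integralClosure R L, (b : L) ∈ O := by
    intro O hO b
    obtain ⟨p, hp, hpb⟩ := b.2
    have : IsIntegral O (b : L) := by
      refine ⟨p.map (R.subtype.codRestrict O fun r => hO r.2), hp.map _, ?_⟩
      rw [eval₂_map]
      exact hpb
    obtain ⟨y, hy⟩ := IsIntegrallyClosed.isIntegral_iff.mp this
    rw [← hy]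
    exact y.2
  have hunit : ∀ (O : ValuationSubring L) (z : L), z ∈ O → z ∉ O.nonunits → z ≠ 0 ∧ z⁻¹ ∈ O := by
    intro O z _ hz
    rw [ValuationSubring.mem_nonunits_iff_or] at hz
    push Not at hz
    exact hz
  have hnu : ∀ (O : ValuationSubring L) (z w : L), z ∈ O.nonunits → w ∈ O → z * w ∈ O.nonunits := by
    intro O z w hz hw
    rw [ValuationSubring.mem_nonunits_iff] at hz ⊢
    rw [map_mul]
    exact mul_lt_one_of_lt_of_le hz ((O.valuation_le_one_iff w).mpr hw)
  have hnuO : ∀ (O : ValuationSubring L) (z : L), z ∈ O.nonunits → z ∈ O := fun O z hz =>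
    (O.valuation_le_one_iff z).mp (O.mem_nonunits_iff.mp hz).le
  have hset : ∀ (O : ValuationSubring L) (𝔭 : Ideal (integralClosure R L)), (R : Set L) ⊆ O →
      𝔭 ≠ ⊤ → (∀ b : integralClosure R L, b ∈ 𝔭 ↔ (b : L) ∈ O.nonunits) →
      (O : Set L) = {z : L | ∃ b s : integralClosure R L, s ∉ 𝔭 ∧ z * (s : L) = (b : L)} := by
    intro O 𝔭 hO h𝔭 hmem
    have hs : ∀ s : integralClosure R L, s ∉ 𝔭 → (s : L) ≠ 0 ∧ (s : L)⁻¹ ∈ O := fun s hs =>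
      hunit O s (hBO O hO s) (mt (hmem s).mpr hs)
    ext z
    constructor
    · intro hz
      obtain ⟨b, s, hsp, h | h⟩ := key 𝔭 h𝔭 z
      · exact ⟨b, s, hsp, h⟩
      · refine ⟨s, b, fun hb => hsp ?_, h⟩
        rw [hmem, ← h, mul_comm]
        exact hnu O _ _ ((hmem b).mp hb) hz
    · rintro ⟨b, s, hsp, h⟩
      rw [← eq_mul_inv_iff_mul_eq₀ (hs s hsp).1] at h
      rw [h]
      exact mul_mem (hBO O hO b) (hs s hsp).2
  refine ⟨fun O _ hOtop hO => ?_, fun 𝔭 h𝔭 => ?_⟩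
  · let 𝔭 : Ideal (integralClosure R L) :=
      { carrier := {b | (b : L) ∈ O.nonunits}
        add_mem' := fun ha hb => O.nonunits.add_mem ha hb
        zero_mem' := zero_mem O.nonunits
        smul_mem' := fun c x hx => by
          change (c : L) * (x : L) ∈ O.nonunits
          rw [mul_comm]
          exact hnu O _ _ hx (hBO O hO c) }
    have hmem : ∀ b : integralClosure R L, b ∈ 𝔭 ↔ (b : L) ∈ O.nonunits := fun _ => Iff.rfl
    have hprime : 𝔭.IsPrime := by
      refine Ideal.isPrime_iff.mpr ⟨fun h => ?_, fun {x y} hxy => ?_⟩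
      · have h1 := (hmem 1).mp (h ▸ Submodule.mem_top)
        rw [ValuationSubring.mem_nonunits_iff] at h1
        simp at h1
      · by_contra! hcon
        rw [hmem, ValuationSubring.mem_nonunits_iff] at hxy
        simp only [hmem, ValuationSubring.mem_nonunits_iff, not_lt] at hcon
        refine hxy.not_ge ?_
        rw [Subalgebra.coe_mul, map_mul]
        exact one_le_mul hcon.1 hcon.2
    have hbot : 𝔭 ≠ ⊥ := by
      intro h
      refine hOtop (eq_top_iff.mpr fun z _ => ?_)
      obtain ⟨a, b, hb, hz⟩ := hRfrac z
      have hb' : (⟨b, hRB b⟩ : integralClosure R L) ∉ 𝔭 := by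
        rw [h, Ideal.mem_bot]
        exact fun h0 => hb (Subtype.ext (congrArg (fun x : integralClosure R L => (x : L)) h0))
      obtain ⟨hb0, hbinv⟩ := hunit O b (hO b.2) (mt (hmem ⟨b, hRB b⟩).mpr hb')
      rw [← eq_mul_inv_iff_mul_eq₀ hb0] at hz
      rw [hz]
      exact mul_mem (hO a.2) hbinv
    have hOset := hset O 𝔭 hO hprime.ne_top hmem
    refine ⟨𝔭, ⟨hprime.isMaximal hbot, hmem, hOset, ?_⟩, fun 𝔮 h𝔮 => ?_⟩
    · ext z
      constructor
      · intro hz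
        obtain ⟨b, s, hs, h⟩ : z ∈ {z : L | ∃ b s : integralClosure R L, s ∉ 𝔭 ∧ z * (s : L) = b} :=
          hOset ▸ hnuO O z hz
        refine ⟨b, s, ?_, hs, h⟩
        rw [hmem, ← h]
        exact hnu O _ _ hz (hBO O hO s)
      · rintro ⟨b, s, hb, hs, h⟩
        obtain ⟨hs0, hsinv⟩ := hunit O s (hBO O hO s) (mt (hmem s).mpr hs)
        rw [← eq_mul_inv_iff_mul_eq₀ hs0] at h
        rw [Set.mem_ofPred_eq, h]
        exact hnu O _ _ hb hsinv
    · ext b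
      rw [h𝔮.2.1, hmem]
  · obtain ⟨O, hBO', h𝔭O⟩ := Ideal.image_subset_nonunits_valuationSubring
      (A := (integralClosure R L).toSubring) 𝔭 h𝔭.ne_top
    have hO : (R : Set L) ⊆ O := fun r hr => hBO' (hRB ⟨r, hr⟩)
    have hle : ∀ b : integralClosure R L, b ∈ 𝔭 → (b : L) ∈ O.nonunits :=
      fun b hb => h𝔭O ⟨b, hb, rfl⟩
    have hmem : ∀ b : integralClosure R L, b ∈ 𝔭 ↔ (b : L) ∈ O.nonunits := by
      refine fun b => ⟨hle b, fun hb => ?_⟩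
      by_contra hb𝔭
      obtain ⟨c, hc⟩ := h𝔭.exists_inv hb𝔭
      obtain ⟨p, hp, h1⟩ := hc
      have h1' : (1 : L) ∈ O.nonunits := by
        have : (c : L) * b + p = 1 := congrArg Subtype.val h1
        rw [← this, mul_comm]
        exact add_mem (hnu O _ _ hb (hBO O hO c)) (hle p hp)
      rw [ValuationSubring.mem_nonunits_iff] at h1'
      simp at h1'
    have hbot : 𝔭 ≠ ⊥ := by
      rintro rfl
      refine hRnf ?_
      have hB : IsField (integralClosure R L) :=
        Ring.isField_iff_maximal_bot.mpr h𝔭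
      exact isField_of_isIntegral_of_isField (S := integralClosure R L)
        (fun x y h => Subtype.ext (congrArg (fun x : integralClosure R L => (x : L)) h)) hB
    refine ⟨O, ⟨⟨fun a => hO (R.algebraMap_mem a), ?_, hO⟩, hmem⟩, ?_⟩
    · rintro rfl
      obtain ⟨b, hb, hb0⟩ := Submodule.exists_mem_ne_zero_of_ne_bot hbot
      rcases ValuationSubring.mem_nonunits_iff_or _ |>.mp (hle b hb) with h | h
      · exact hb0 (Subtype.ext h)
      · exact h (ValuationSubring.mem_top _)
    · rintro O' ⟨⟨_, _, hO'⟩, hmem'⟩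
      exact SetLike.coe_injective
        ((hset O' 𝔭 hO' h𝔭.ne_top hmem').trans (hset O 𝔭 hO h𝔭.ne_top hmem).symm)
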